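/- Let n ≥ 3 and 1 ≤ i < j ≤ n. (a) For all l₁ ∈ {1,…,n}∖{i,j} and l₂ ∈ {1,…,n}∖{j} with l₁ ≠ l₂: (n−2)·#{σ ∈ D_n : σ(σ(j)) ≠ j, σ(l₁) = i, σ(l₂) = j} = d_{n−1}. (b) For all l₂ ∈ {1,…,n}∖{i,j}: (n−2)·#{σ ∈ D_n : σ(σ(j)) ≠ j, σ(j) = i, σ(l₂) = j} = d_{n−1}. Equivalently, conditioned on a uniformly random derangement of {1,…,n} having j in a cycle of length at least 3, the pair of positions (σ⁻¹(i), σ⁻¹(j)) is uniformly distributed over the (n−2)(n−1) pairs described in (a) and (b). -/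

import Mathlib

/-- Number of inversions of a permutation of `Fin n`: the number of pairs of
positions `a < b` with `σ a > σ b`. -/
def inversions {n : ℕ} (σ : Equiv.Perm (Fin n)) : ℕ :=
  ((Finset.univ : Finset (Fin n × Fin n)).filter
    (fun p => p.1 < p.2 ∧ σ p.2 < σ p.1)).card

/-- The set of derangements (fixed-point-free permutations) of `Fin n`. -/
def derangeSet (n : ℕ) : Finset (Equiv.Perm (Fin n)) :=
  Finset.univ.filter (fun σ => ∀ x, σ x ≠ x)

/-- The number of derangements of `Fin n` (so `numDerange 0 = 1`). -/
def numDerange (n : ℕ) : ℕ := (derangeSet n).card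

/-- The number of fixed points of a permutation of `Fin n`. -/
def fixedPointCount {n : ℕ} (σ : Equiv.Perm (Fin n)) : ℕ :=
  (Finset.univ.filter (fun x => σ x = x)).card

/-- The set of permutations of `Fin n` with exactly `k` fixed points. -/
def permsWithFixed (n k : ℕ) : Finset (Equiv.Perm (Fin n)) :=
  Finset.univ.filter (fun σ => fixedPointCount σ = k)

/-- The number of permutations of `Fin n` with exactly `k` fixed points. -/
def numPermsWithFixed (n k : ℕ) : ℕ := (permsWithFixed n k).card

/-- The permutations of `α` whose only fixed point is `j`. -/
def permsFixingOnly {α : Type*} [Fintype α] [DecidableEq α] (j : α) : Finset (Equiv.Perm α) :=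
  Finset.univ.filter (fun τ => ∀ x, τ x = x ↔ x = j)

theorem mem_permsFixingOnly {α : Type*} [Fintype α] [DecidableEq α] {j : α}
    {τ : Equiv.Perm α} : τ ∈ permsFixingOnly j ↔ ∀ x, τ x = x ↔ x = j := by
  simp [permsFixingOnly]

theorem numDerange_eq_numDerangements (n : ℕ) : numDerange n = numDerangements n := by
  rw [← card_derangements_fin_eq_numDerangements, numDerange, derangeSet,
    ← Fintype.card_subtype]
  exact Fintype.card_congr (Equiv.refl _)

theorem card_permsFixingOnly {α : Type*} [Fintype α] [DecidableEq α] (j : α) :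
    (permsFixingOnly j).card = numDerange (Fintype.card α - 1) := by
  have h := Fintype.card_congr (derangements.subtypeEquiv (fun a : α => a ≠ j))
  rw [card_derangements_eq_numDerangements, Fintype.card_subtype_compl,
    Fintype.card_subtype_eq] at h
  rw [numDerange_eq_numDerangements, h, Fintype.card_subtype]
  congr 1
  ext τ
  simp [mem_permsFixingOnly, Function.mem_fixedPoints, Function.IsFixedPt, eq_comm, iff_comm]

/-- All values of the preimage of `i` other than `i` and `j` are equally frequent among
the permutations whose only fixed point is `j`. -/
theorem card_permsFixingOnly_filter_congr {α : Type*} [Fintype α] [DecidableEq α]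
    {i j l m : α} (hli : l ≠ i) (hlj : l ≠ j) (hmi : m ≠ i) (hmj : m ≠ j) :
    ((permsFixingOnly j).filter (fun τ => τ l = i)).card =
      ((permsFixingOnly j).filter (fun τ => τ m = i)).card := by
  refine Finset.card_equiv (MulAut.conj (Equiv.swap l m)).toEquiv fun τ => ?_
  have hj : Equiv.swap l m j = j := Equiv.swap_apply_of_ne_of_ne hlj.symm hmj.symm
  have hi : Equiv.swap l m i = i := Equiv.swap_apply_of_ne_of_ne hli.symm hmi.symm
  have key : ∀ x y, Equiv.swap l m x = y ↔ x = Equiv.swap l m y := fun x y => by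
    rw [Equiv.swap_apply_eq_iff]
  simp only [Finset.mem_filter, mem_permsFixingOnly, MulEquiv.toEquiv_eq_coe,
    MulEquiv.coe_toEquiv, MulAut.conj_apply, Equiv.swap_inv, Equiv.Perm.mul_apply, key, hi,
    Equiv.swap_apply_right]
  refine and_congr_left fun _ => ⟨fun h x => ?_, fun h x => ?_⟩
  · rw [h, key, hj]
  · have := h (Equiv.swap l m x)
    rwa [Equiv.swap_apply_self, key, hj] at this

theorem card_sub_two_mul_card_permsFixingOnly_filter {α : Type*} [Fintype α] [DecidableEq α]
    {i j l : α} (hij : i ≠ j) (hli : l ≠ i) (hlj : l ≠ j) :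
    (Fintype.card α - 2) * ((permsFixingOnly j).filter (fun τ => τ l = i)).card =
      numDerange (Fintype.card α - 1) := by
  have hmaps : ∀ τ ∈ permsFixingOnly j, τ.symm i ∈ ({i, j}ᶜ : Finset α) := by
    intro τ hτ
    rw [mem_permsFixingOnly] at hτ
    simp only [Finset.mem_compl, Finset.mem_insert, Finset.mem_singleton, not_or,
      Equiv.symm_apply_eq]
    exact ⟨fun h => hij ((hτ i).1 h.symm), fun h => hij (h.trans ((hτ j).2 rfl))⟩
  rw [← card_permsFixingOnly j, Finset.card_eq_sum_card_fiberwise hmaps,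
    Finset.sum_congr rfl (g := fun _ => ((permsFixingOnly j).filter (fun τ => τ l = i)).card),
    Finset.sum_const, Finset.card_compl, Finset.card_pair hij, smul_eq_mul]
  intro m hm
  simp only [Finset.mem_compl, Finset.mem_insert, Finset.mem_singleton, not_or] at hm
  rw [card_permsFixingOnly_filter_congr hli hlj hm.1 hm.2]
  simp only [Equiv.symm_apply_eq, @eq_comm _ i]

/-- Right multiplication by `swap j l` removes `j` from its cycle in a derangement sending
`l` to `j`. -/
theorem mul_swap_mem_permsFixingOnly_iff {n : ℕ} {j l : Fin n} (hlj : l ≠ j)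
    (σ : Equiv.Perm (Fin n)) :
    σ * Equiv.swap j l ∈ permsFixingOnly j ↔
      σ ∈ derangeSet n ∧ σ (σ j) ≠ j ∧ σ l = j := by
  simp only [mem_permsFixingOnly, derangeSet, Finset.mem_filter, Finset.mem_univ, true_and,
    Equiv.Perm.mul_apply]
  constructor
  · intro h
    have hσl : σ l = j := by simpa using (h j).2 rfl
    have hσj : σ j ≠ l := fun e => hlj ((h l).1 (by simpa using e))
    refine ⟨fun x hx => ?_, fun e => hσj (σ.injective (e.trans hσl.symm)), hσl⟩
    by_cases hxj : x = j
    · subst hxj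
      exact hlj (σ.injective (hσl.trans hx.symm))
    by_cases hxl : x = l
    · subst hxl
      exact hlj (hx.symm.trans hσl)
    · exact hxj ((h x).1 (by rwa [Equiv.swap_apply_of_ne_of_ne hxj hxl]))
  · rintro ⟨hd, hc, hσl⟩ x
    by_cases hxj : x = j
    · subst hxj
      simpa using hσl
    by_cases hxl : x = l
    · subst hxl
      simp only [Equiv.swap_apply_right, hxj, iff_false]
      exact fun e => hc (by rw [e, hσl])
    · rw [Equiv.swap_apply_of_ne_of_ne hxj hxl]
      exact iff_of_false (hd x) hxj

theorem sub_two_mul_card_derangeSet_filter {n : ℕ} {i j k l : Fin n} (hij : i ≠ j)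
    (hlj : l ≠ j) (hki : Equiv.swap j l k ≠ i) (hkj : Equiv.swap j l k ≠ j) :
    (n - 2) * ((derangeSet n).filter
      (fun σ => σ (σ j) ≠ j ∧ σ k = i ∧ σ l = j)).card = numDerange (n - 1) := by
  have h := card_sub_two_mul_card_permsFixingOnly_filter hij hki hkj
  rw [Fintype.card_fin] at h
  rw [← h]
  congr 1
  refine Finset.card_equiv (Equiv.mulRight (Equiv.swap j l)) fun σ => ?_
  rw [Equiv.coe_mulRight, Finset.mem_filter, Finset.mem_filter,
    mul_swap_mem_permsFixingOnly_iff hlj, Equiv.Perm.mul_apply, Equiv.swap_apply_self]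
  tauto

/-- Conditioned on a uniformly random derangement of `{1,…,n}` having `j` in a cycle of
length at least 3, the pair of positions `(σ⁻¹ i, σ⁻¹ j)` is uniformly distributed over
the pairs described in parts (a) and (b). -/
theorem stmt14 (n i j : ℕ) (hn : 3 ≤ n) (hi : 1 ≤ i) (hij : i < j) (hj : j ≤ n) :
    (∀ l₁ l₂ : ℕ, ∀ _h1 : 1 ≤ l₁, ∀ _h2 : l₁ ≤ n, ∀ _h3 : l₁ ≠ i, ∀ _h4 : l₁ ≠ j,
      ∀ _h5 : 1 ≤ l₂, ∀ _h6 : l₂ ≤ n, ∀ _h7 : l₂ ≠ j, ∀ _h8 : l₁ ≠ l₂,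
      (n - 2) * ((derangeSet n).filter
          (fun σ => σ (σ (⟨j - 1, by omega⟩ : Fin n)) ≠ (⟨j - 1, by omega⟩ : Fin n) ∧
            σ (⟨l₁ - 1, by omega⟩ : Fin n) = (⟨i - 1, by omega⟩ : Fin n) ∧
            σ (⟨l₂ - 1, by omega⟩ : Fin n) = (⟨j - 1, by omega⟩ : Fin n))).card =
        numDerange (n - 1)) ∧
    (∀ l₂ : ℕ, ∀ _h1 : 1 ≤ l₂, ∀ _h2 : l₂ ≤ n, ∀ _h3 : l₂ ≠ i, ∀ _h4 : l₂ ≠ j,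
      (n - 2) * ((derangeSet n).filter
          (fun σ => σ (σ (⟨j - 1, by omega⟩ : Fin n)) ≠ (⟨j - 1, by omega⟩ : Fin n) ∧
            σ (⟨j - 1, by omega⟩ : Fin n) = (⟨i - 1, by omega⟩ : Fin n) ∧
            σ (⟨l₂ - 1, by omega⟩ : Fin n) = (⟨j - 1, by omega⟩ : Fin n))).card =
        numDerange (n - 1)) := by
  have ne {a b : ℕ} (ha : a < n) (hb : b < n) (h : a ≠ b) : (⟨a, ha⟩ : Fin n) ≠ ⟨b, hb⟩ :=
    Fin.ne_of_val_ne h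
  constructor
  · intro l₁ l₂ h1 h2 h3 h4 h5 h6 h7 h8
    have hswap : Equiv.swap (⟨j - 1, by omega⟩ : Fin n) ⟨l₂ - 1, by omega⟩ ⟨l₁ - 1, by omega⟩ =
        ⟨l₁ - 1, by omega⟩ :=
      Equiv.swap_apply_of_ne_of_ne (ne _ _ (by omega)) (ne _ _ (by omega))
    refine sub_two_mul_card_derangeSet_filter (ne _ _ (by omega)) (ne _ _ (by omega)) ?_ ?_ <;>
      rw [hswap] <;> exact ne _ _ (by omega)
  · intro l₂ h1 h2 h3 h4
    refine sub_two_mul_card_derangeSet_filter (ne _ _ (by omega)) (ne _ _ (by omega)) ?_ ?_ <;>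
      rw [Equiv.swap_apply_left] <;> exact ne _ _ (by omega)
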